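/- arXiv:1808.09439 — 2 statements merged into one kernel-verified Lean document; each statement's English description precedes it below -/
import Mathlib

section
/- Let k be an algebraically closed field, P : k^N → k a homogeneous polynomial of degree d ≥ 2 of Schmidt rank r. Then the singular locus X_sing of the hypersurface X = {P = 0} has codimension in X at most 2dr. -/
namespace MvPolynomial

/-- The endomorphism of `k[X_0, …, X_{N-1}]` killing the variables of index less than `i`. -/
noncomputable def killLT (k : Type*) [Field k] (N i : ℕ) :
    MvPolynomial (Fin N) k →ₐ[k] MvPolynomial (Fin N) k :=
  aeval fun j => if j.val < i then 0 else X j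

lemma ker_killLT_mono (k : Type*) [Field k] (N : ℕ) {i j : ℕ} (hij : i ≤ j) :
    RingHom.ker (killLT k N i) ≤ RingHom.ker (killLT k N j) := by
  have hcomp : (killLT k N j).comp (killLT k N i) = killLT k N j := by
    ext1 l
    by_cases hl : l.val < i
    · simp [killLT, hl, hl.trans_le hij]
    · simp [killLT, hl]
  intro f hf
  rw [RingHom.mem_ker] at hf ⊢
  rw [← hcomp, AlgHom.comp_apply, hf, map_zero]

lemma ker_killLT_lt (k : Type*) [Field k] (N : ℕ) {i j : ℕ} (hij : i < j) (hi : i < N) :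
    RingHom.ker (killLT k N i) < RingHom.ker (killLT k N j) := by
  refine lt_of_le_of_ne (ker_killLT_mono k N hij.le) fun h => ?_
  have hmem : (X ⟨i, hi⟩ : MvPolynomial (Fin N) k) ∈ RingHom.ker (killLT k N j) := by
    simp [killLT, hij]
  rw [← h, RingHom.mem_ker] at hmem
  simp [killLT] at hmem

lemma ker_killLT_self (k : Type*) [Field k] (N : ℕ) :
    RingHom.ker (killLT k N N) = RingHom.ker (constantCoeff (σ := Fin N) (R := k)) := by
  ext f
  have h : (fun j : Fin N => if j.val < N then (0 : MvPolynomial (Fin N) k) else X j) =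
      fun _ => 0 := by
    ext1 j
    simp
  rw [RingHom.mem_ker, RingHom.mem_ker, killLT, h, aeval_zero']
  simp

/-- The ideal of the origin in affine `N`-space has height at least `N`. -/
lemma le_height_ker_constantCoeff (k : Type*) [Field k] (N : ℕ) :
    (N : ℕ∞) ≤ (RingHom.ker (constantCoeff (σ := Fin N) (R := k))).height := by
  let c : LTSeries (PrimeSpectrum (MvPolynomial (Fin N) k)) :=
    LTSeries.mk N (fun i => ⟨RingHom.ker (killLT k N i), RingHom.ker_isPrime _⟩)
      fun i j hij => ker_killLT_lt k N hij (by have := j.isLt; have : i.val < j.val := hij; omega)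
  have h := Order.length_le_height_last (p := c)
  rw [← PrimeSpectrum.height_eq_orderHeight] at h
  have hlast : c.last.asIdeal = RingHom.ker (constantCoeff (σ := Fin N) (R := k)) := by
    rw [← ker_killLT_self]
    rfl
  rwa [hlast] at h

lemma sum_homogeneousComponent_range {σ R : Type*} [CommSemiring R] (f : MvPolynomial σ R)
    {d : ℕ} (hf : f.totalDegree < d) :
    ∑ a ∈ Finset.range d, homogeneousComponent a f = f := by
  conv_rhs => rw [← sum_homogeneousComponent f]
  refine (Finset.sum_subset (Finset.range_mono hf) fun a _ ha => ?_).symm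
  exact homogeneousComponent_eq_zero _ _ (by simpa using ha)

/-- If an ideal contains all components of degrees `1, …, d` of two polynomials of degree less
than `d`, then its square contains the component of degree `d` of their product. -/
lemma homogeneousComponent_mul_mem_sq {σ R : Type*} [CommRing R] {f g : MvPolynomial σ R}
    {d : ℕ} (hf : f.totalDegree < d) (hg : g.totalDegree < d) (J : Ideal (MvPolynomial σ R))
    (hfJ : ∀ a < d, homogeneousComponent (a + 1) f ∈ J)
    (hgJ : ∀ a < d, homogeneousComponent (a + 1) g ∈ J) :
    homogeneousComponent d (f * g) ∈ J * J := by
  rw [← sum_homogeneousComponent_range f hf, ← sum_homogeneousComponent_range g hg]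
  rw [Finset.sum_mul_sum, map_sum]
  refine sum_mem fun a ha => ?_
  rw [map_sum]
  refine sum_mem fun b hb => ?_
  rw [homogeneousComponent_of_mem ((mem_homogeneousSubmodule _ _).2
    ((homogeneousComponent_isHomogeneous a f).mul (homogeneousComponent_isHomogeneous b g)))]
  rw [Finset.mem_range] at ha hb
  split_ifs with hab
  · obtain ⟨a, rfl⟩ := Nat.exists_eq_succ_of_ne_zero (show a ≠ 0 by omega)
    obtain ⟨b, rfl⟩ := Nat.exists_eq_succ_of_ne_zero (show b ≠ 0 by omega)
    exact Ideal.mul_mem_mul (hfJ a (by omega)) (hgJ b (by omega))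
  · exact zero_mem _

lemma pderiv_mem_of_mem_sq {σ R : Type*} [CommRing R] {J : Ideal (MvPolynomial σ R)}
    {f : MvPolynomial σ R} (hf : f ∈ J * J) (l : σ) : pderiv l f ∈ J := by
  refine Submodule.mul_induction_on hf (fun a ha b hb => ?_) fun a b ha hb => ?_
  · rw [Derivation.leibniz]
    exact add_mem (J.mul_mem_right _ ha) (J.mul_mem_right _ hb)
  · rw [map_add]
    exact add_mem ha hb

end MvPolynomial

open MvPolynomial in
/-- over an algebraically closed field, if `P` is homogeneous of
degree `d ≥ 2` of Schmidt rank `≤ r` (i.e. `P = Σ_{i=1}^r Q_i R_i` with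
`deg Q_i, deg R_i < d`), then the singular locus `X_sing` of `X = {P = 0}` has
codimension at most `2dr` in `X`; we express this as
`dim X ≤ dim X_sing + 2dr` with dimensions of the corresponding coordinate
rings. -/
theorem stmt_5 {k : Type*} [Field k] [IsAlgClosed k] (N d r : ℕ) (hd : 2 ≤ d)
    (P : MvPolynomial (Fin N) k) (hP : P.IsHomogeneous d)
    (Q R : Fin r → MvPolynomial (Fin N) k)
    (hQR : ∀ i, (Q i).totalDegree < d ∧ (R i).totalDegree < d)
    (hsum : P = ∑ i, Q i * R i) :
    ringKrullDim (MvPolynomial (Fin N) k ⧸ Ideal.span {P}) ≤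
      ringKrullDim (MvPolynomial (Fin N) k ⧸
        Ideal.span ({P} ∪ Set.range fun l => MvPolynomial.pderiv l P)) +
      (2 * d * r : ℕ) := by
  let F : (Fin r ⊕ Fin r) × Fin d → MvPolynomial (Fin N) k :=
    fun t => homogeneousComponent (t.2.val + 1) (Sum.elim Q R t.1)
  let J := Ideal.span (Set.range F)
  have hPJ : P ∈ J * J := by
    rw [← homogeneousComponent_eq_self hP, hsum, map_sum]
    refine sum_mem fun i _ => homogeneousComponent_mul_mem_sq (hQR i).1 (hQR i).2 J ?_ ?_
    · exact fun a ha => Ideal.subset_span ⟨(Sum.inl i, ⟨a, ha⟩), rfl⟩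
    · exact fun a ha => Ideal.subset_span ⟨(Sum.inr i, ⟨a, ha⟩), rfl⟩
  have hle : Ideal.span ({P} ∪ Set.range fun l => pderiv l P) ≤ J := by
    rw [Ideal.span_le, Set.union_subset_iff, Set.singleton_subset_iff, Set.range_subset_iff]
    exact ⟨Ideal.mul_le_left hPJ, fun l => pderiv_mem_of_mem_sq hPJ l⟩
  have hm : Set.range F ⊆ RingHom.ker (constantCoeff (σ := Fin N) (R := k)) := by
    rintro _ ⟨t, rfl⟩
    simp [F, RingHom.mem_ker, constantCoeff_eq, coeff_homogeneousComponent]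
  have hcard : (Set.range F).encard ≤ (2 * d * r : ℕ) := by
    rw [← Set.image_univ]
    refine (Set.encard_image_le _ _).trans ?_
    rw [Set.encard_univ, ENat.card_eq_coe_fintype_card]
    simp only [Fintype.card_prod, Fintype.card_sum, Fintype.card_fin]
    exact_mod_cast (show (r + r) * d ≤ 2 * d * r by nlinarith)
  have : (RingHom.ker (constantCoeff (σ := Fin N) (R := k))).IsPrime := RingHom.ker_isPrime _
  calc ringKrullDim (MvPolynomial (Fin N) k ⧸ Ideal.span {P})
      ≤ ringKrullDim (MvPolynomial (Fin N) k) := ringKrullDim_quotient_le _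
    _ = N := by simp [ringKrullDim_of_isNoetherianRing]
    _ ≤ (RingHom.ker (constantCoeff (σ := Fin N) (R := k))).height := by
        exact_mod_cast le_height_ker_constantCoeff k N
    _ ≤ ringKrullDim (MvPolynomial (Fin N) k ⧸ J) + (Set.range F).encard :=
        Ideal.height_le_ringKrullDim_quotient_add_encard _ hm
    _ ≤ _ := by
        refine add_le_add (ringKrullDim_le_of_surjective _ (Ideal.Quotient.factor_surjective hle)) ?_
        exact WithBot.coe_le_coe.mpr hcard
end

section
/- Let k be a finite field of q elements with char(k) > d, V a finite-dimensional k-vector space, P : V → k of degree d, and W = Hom_aff(k^m, V) the space of affine maps. Suppose the Schmidt rank of P exceeds a threshold r(m, d) (given by the bias-rank theorem with parameter s = 2·d^m). Then the map W → P_d(k^m), w ↦ P ∘ w, sending an affine map to the pulled-back polynomial of degree ≤ d on k^m, is surjective: every polynomial Q of degree ≤ d on k^m equals P ∘ w for some affine map w : k^m → V. -/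
/-- The Schmidt rank (relative to degree `d`) of a polynomial: the minimal `r`
such that `P = Σ_{i=1}^r Q_i R_i` with `deg Q_i, deg R_i < d`. -/
noncomputable def schmidtRank {k : Type*} [CommRing k] {σ : Type*} (d : ℕ)
    (P : MvPolynomial σ k) : ℕ :=
  sInf {r : ℕ | ∃ Q R : Fin r → MvPolynomial σ k,
    (∀ i, (Q i).totalDegree < d ∧ (R i).totalDegree < d) ∧ P = ∑ i, Q i * R i}

open Finset Function

/-- `c` is linear in each coordinate from `J` and does not depend on the other coordinates. -/
structure IsMultilinearOn {ι k V : Type*} [DecidableEq ι] [Field k] [AddCommGroup V] [Module k V]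
    (J : Finset ι) (c : (ι → V) → k) : Prop where
  add : ∀ i ∈ J, ∀ (u : ι → V) (x y : V),
    c (update u i (x + y)) = c (update u i x) + c (update u i y)
  smul : ∀ i ∈ J, ∀ (u : ι → V) (a : k) (x : V), c (update u i (a • x)) = a * c (update u i x)
  congr : ∀ u v : ι → V, (∀ i ∈ J, u i = v i) → c u = c v

namespace IsMultilinearOn

variable {ι k V : Type*} [DecidableEq ι] [Field k] [AddCommGroup V] [Module k V]
  {J J' : Finset ι} {c c' : (ι → V) → k}

theorem eq_zero (h : IsMultilinearOn J c) {u : ι → V} {i : ι} (hi : i ∈ J) (hu : u i = 0) :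
    c u = 0 := by
  have := h.smul i hi u 0 0
  rwa [zero_smul, zero_mul, ← hu, update_eq_self] at this

theorem piecewise (h : IsMultilinearOn J c) (s : Finset ι) (w : ι → V) :
    IsMultilinearOn (J ∩ s) (fun u => c (s.piecewise u w)) where
  add i hi u x y := by
    have hs := (mem_inter.1 hi).2
    simp only [← s.update_piecewise_of_mem _ _ hs]
    exact h.add i (mem_inter.1 hi).1 _ x y
  smul i hi u a x := by
    have hs := (mem_inter.1 hi).2
    simp only [← s.update_piecewise_of_mem _ _ hs]
    exact h.smul i (mem_inter.1 hi).1 _ a x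
  congr u v huv := h.congr _ _ fun i hi => by
    by_cases hs : i ∈ s
    · simpa [hs] using huv i (mem_inter.2 ⟨hi, hs⟩)
    · simp [hs]

theorem mul (h : IsMultilinearOn J c) (h' : IsMultilinearOn J' c') (hd : Disjoint J J') :
    IsMultilinearOn (J ∪ J') (fun u => c u * c' u) where
  add i hi u x y := by
    rcases mem_union.1 hi with hi | hi
    · have hi' : i ∉ J' := Finset.disjoint_left.1 hd hi
      have e : ∀ z, c' (update u i z) = c' u := fun z => h'.congr _ _ fun j hj =>
        update_of_ne (by rintro rfl; exact hi' hj) _ _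
      rw [h.add i hi, e, e, e]; ring
    · have hi' : i ∉ J := Finset.disjoint_right.1 hd hi
      have e : ∀ z, c (update u i z) = c u := fun z => h.congr _ _ fun j hj =>
        update_of_ne (by rintro rfl; exact hi' hj) _ _
      rw [h'.add i hi, e, e, e]; ring
  smul i hi u a x := by
    rcases mem_union.1 hi with hi | hi
    · have hi' : i ∉ J' := Finset.disjoint_left.1 hd hi
      have e : ∀ z, c' (update u i z) = c' u := fun z => h'.congr _ _ fun j hj =>
        update_of_ne (by rintro rfl; exact hi' hj) _ _
      rw [h.smul i hi, e, e]; ring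
    · have hi' : i ∉ J := Finset.disjoint_right.1 hd hi
      have e : ∀ z, c (update u i z) = c u := fun z => h.congr _ _ fun j hj =>
        update_of_ne (by rintro rfl; exact hi' hj) _ _
      rw [h'.smul i hi, e, e]; ring
  congr u v huv := by
    rw [h.congr u v fun i hi => huv i (mem_union_left _ hi),
      h'.congr u v fun i hi => huv i (mem_union_right _ hi)]

theorem sub (h : IsMultilinearOn J c) (h' : IsMultilinearOn J c') :
    IsMultilinearOn J (fun u => c u - c' u) where
  add i hi u x y := by rw [h.add i hi, h'.add i hi]; ring
  smul i hi u a x := by rw [h.smul i hi, h'.smul i hi]; ring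
  congr u v huv := by rw [h.congr u v huv, h'.congr u v huv]

theorem map_add (h : IsMultilinearOn J c) (u w : ι → V) :
    c (u + w) = ∑ s ∈ J.powerset, c (s.piecewise u w) := by
  induction J using Finset.induction_on generalizing c with
  | empty => simpa using h.congr _ _ (by simp)
  | insert i J hi ih =>
    have key : ∀ x : V, IsMultilinearOn J (fun v => c (update v i x)) := fun x =>
      { add := fun j hj v y z => by
          have hji : j ≠ i := fun e => hi (e ▸ hj)
          simp only [update_comm hji]
          exact h.add j (mem_insert_of_mem hj) _ y z
        smul := fun j hj v a y => by
          have hji : j ≠ i := fun e => hi (e ▸ hj)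
          simp only [update_comm hji]
          exact h.smul j (mem_insert_of_mem hj) _ a y
        congr := fun v v' hv => h.congr _ _ fun j hj => by
          rcases eq_or_ne j i with rfl | hji
          · simp
          · simpa [hji] using hv j ((mem_insert.1 hj).resolve_left hji) }
    have e : c (u + w) = c (update (u + w) i (u i)) + c (update (u + w) i (w i)) := by
      rw [← h.add i (mem_insert_self i J), ← Pi.add_apply, update_eq_self]
    rw [e, ih (key (u i)), ih (key (w i)), sum_powerset_insert hi, add_comm]
    congr 1
    · refine sum_congr rfl fun s hs => congrArg c ?_
      have his : i ∉ s := fun h => hi (mem_powerset.1 hs h)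
      ext j
      rcases eq_or_ne j i with rfl | hji <;> simp [*]
    · refine sum_congr rfl fun s hs => congrArg c ?_
      rw [piecewise_insert]

/-- Additivity of a form whose mixed evaluations all vanish. -/
theorem map_add_of_mixed_eq_zero (h : IsMultilinearOn J c) (hJ : J.Nonempty) (u w : ι → V)
    (hmix : ∀ s : Finset ι, (J ∩ s).Nonempty → ¬ J ⊆ s → c (s.piecewise u w) = 0) :
    c (u + w) = c u + c w := by
  rw [h.map_add]
  have hne : J ≠ ∅ := hJ.ne_empty
  rw [← sum_subset (s₁ := {J, ∅}) (by intro s; simp; rintro (rfl | rfl) <;> simp),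
    sum_pair hne]
  · rw [piecewise_empty]
    congr 1
    exact h.congr _ _ fun i hi => by simp [hi]
  · intro s hs hs'
    simp only [mem_insert, mem_singleton, not_or] at hs'
    have hsJ := mem_powerset.1 hs
    refine hmix s ?_ fun h => hs'.1 (Subset.antisymm hsJ h)
    rw [inter_eq_right.2 hsJ]
    exact nonempty_iff_ne_empty.2 hs'.2

theorem piecewise_update_smul_eq_zero (h : IsMultilinearOn J c) {s : Finset ι} {u w : ι → V}
    (h0 : c (s.piecewise u w) = 0) (i : ι) (a : k) :
    c (s.piecewise u (update w i (a • w i))) = 0 := by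
  by_cases hi : i ∈ J ∧ i ∉ s
  · rw [← s.update_piecewise_of_notMem _ _ hi.2, h.smul i hi.1]
    have : update (s.piecewise u w) i (w i) = s.piecewise u w := by
      rw [update_eq_iff]; simp [hi.2]
    rw [this, h0, mul_zero]
  · rw [← h0]
    refine h.congr _ _ fun j hj => ?_
    by_cases hs : j ∈ s
    · simp [hs]
    · have : j ≠ i := fun e => hi ⟨e ▸ hj, e ▸ hs⟩
      simp [hs, this]

end IsMultilinearOn

/-- `T` is a sum of at most `r` products of two forms in complementary nonempty sets of
variables. -/
def PartitionRankLE {ι k V : Type*} [DecidableEq ι] [Fintype ι] [Field k] [AddCommGroup V]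
    [Module k V] (r : ℕ) (T : (ι → V) → k) : Prop :=
  ∃ s ≤ r, ∃ (J : Fin s → Finset ι) (f g : Fin s → (ι → V) → k),
    (∀ t, (J t).Nonempty ∧ J t ≠ univ ∧ IsMultilinearOn (J t) (f t) ∧
      IsMultilinearOn (J t)ᶜ (g t)) ∧ ∀ u, T u = ∑ t, f t u * g t u

theorem PartitionRankLE.mono {ι k V : Type*} [DecidableEq ι] [Fintype ι] [Field k]
    [AddCommGroup V] [Module k V] {r r' : ℕ} {T : (ι → V) → k} (h : PartitionRankLE r T)
    (hr : r ≤ r') : PartitionRankLE r' T := by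
  obtain ⟨s, hs, H⟩ := h
  exact ⟨s, hs.trans hr, H⟩

theorem PartitionRankLE.of_sub_mul {ι k V : Type*} [DecidableEq ι] [Fintype ι] [Field k]
    [AddCommGroup V] [Module k V] {r : ℕ} {T f g : (ι → V) → k} {J : Finset ι}
    (hJ : J.Nonempty) (hJ' : J ≠ univ) (hf : IsMultilinearOn J f) (hg : IsMultilinearOn Jᶜ g)
    (h : PartitionRankLE r fun u => T u - f u * g u) : PartitionRankLE (r + 1) T := by
  obtain ⟨s, hs, J₁, f₁, g₁, h₁, e⟩ := h
  refine ⟨s + 1, by omega, Fin.cons J J₁, Fin.cons f f₁, Fin.cons g g₁, ?_, fun u => ?_⟩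
  · intro t
    refine Fin.cases ?_ (fun t => ?_) t
    · exact ⟨hJ, hJ', hf, hg⟩
    · simpa using h₁ t
  · rw [Fin.sum_univ_succ]
    simp only [Fin.cons_zero, Fin.cons_succ]
    rw [← e u]; ring

/-- The reduction step in the proof that a multilinear form vanishing on the zero locus of few
forms in fewer variables has small partition rank. -/
theorem sub_mul_eq_zero_of_mixed {ι k V κ : Type*} [DecidableEq ι] [Fintype ι] [Field k]
    [AddCommGroup V] [Module k V] {J : κ → Finset ι} {c : κ → (ι → V) → k}
    {T : (ι → V) → k} (hc : ∀ j, IsMultilinearOn (J j) (c j)) (hJ : ∀ j, (J j).Nonempty)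
    (hT : IsMultilinearOn univ T) (hv : ∀ u, (∀ j, c j u = 0) → T u = 0)
    (j₀ : κ) {w : ι → V} (hw : ∀ i ∉ J j₀, w i = 0) (hw₀ : c j₀ w = 1)
    (hw₁ : ∀ j ≠ j₀, c j w = 0) {u : ι → V} (hu : ∀ j ≠ j₀, c j u = 0)
    (hmix : ∀ j s, (J j ∩ s).Nonempty → ¬ J j ⊆ s → c j (s.piecewise u w) = 0) :
    T u - c j₀ u * T ((J j₀).piecewise w u) = 0 := by
  obtain ⟨i, hi⟩ := hJ j₀
  set b := c j₀ u with hb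
  set w' := update w i ((-b) • w i) with hw'
  have hw'0 : ∀ i' ∉ J j₀, w' i' = 0 := fun i' hi' => by
    have : i' ≠ i := fun e => hi' (e ▸ hi)
    rw [hw', update_of_ne this, hw i' hi']
  have hmix' : ∀ j s, (J j ∩ s).Nonempty → ¬ J j ⊆ s → c j (s.piecewise u w') = 0 :=
    fun j s h1 h2 => (hc j).piecewise_update_smul_eq_zero (hmix j s h1 h2) i _
  have hcw' : ∀ j ≠ j₀, c j w' = 0 := fun j hj => by
    have := (hc j).piecewise_update_smul_eq_zero (s := ∅) (u := u) (w := w)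
      (by rw [piecewise_empty]; exact hw₁ j hj) i (-b)
    rwa [piecewise_empty] at this
  have hcw'0 : c j₀ w' = -b := by
    rw [hw', (hc j₀).smul i hi, update_eq_self, hw₀, mul_one]
  have hA : ∀ s : Finset ι, (J j₀ ∩ s).Nonempty → ¬ J j₀ ⊆ s → T (s.piecewise u w') = 0 := by
    intro s h1 h2
    refine hv _ fun j => ?_
    by_cases h3 : J j ⊆ s
    · have hj : j ≠ j₀ := fun e => h2 (e ▸ h3)
      rw [← hu j hj]
      exact (hc j).congr _ _ fun i' hi' => by simp [h3 hi']
    by_cases h4 : (J j ∩ s).Nonempty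
    · exact hmix' j s h4 h3
    · have hj : j ≠ j₀ := fun e => h4 (e ▸ h1)
      rw [← hcw' j hj]
      refine (hc j).congr _ _ fun i' hi' => ?_
      have : i' ∉ s := fun h => h4 ⟨i', mem_inter.2 ⟨hi', h⟩⟩
      simp [this]
  have hB : T (u + w') = 0 := by
    refine hv _ fun j => ?_
    rw [(hc j).map_add_of_mixed_eq_zero (hJ j) u w' (hmix' j)]
    rcases eq_or_ne j j₀ with rfl | hj
    · rw [hcw'0, ← hb, add_neg_cancel]
    · rw [hu j hj, hcw' j hj, add_zero]
  have hT1 := hT.piecewise (J j₀) u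
  rw [univ_inter] at hT1
  have hadd := hT1.map_add_of_mixed_eq_zero (hJ j₀) u w' (fun s h1 h2 => by
    have e : (J j₀).piecewise (s.piecewise u w') u = (s ∪ (J j₀)ᶜ).piecewise u w' := by
      ext i'
      by_cases h3 : i' ∈ J j₀ <;> by_cases h4 : i' ∈ s <;> simp [h3, h4]
    simp only [e]
    refine hA _ (h1.mono fun i' => by simp; tauto) fun h => h2 fun i' hi' => ?_
    simpa [hi'] using h hi')
  have e1 : (J j₀).piecewise (u + w') u = u + w' := by
    ext i'
    by_cases h3 : i' ∈ J j₀ <;> simp [h3, hw'0]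
  have e2 : (J j₀).piecewise u u = u := by ext i'; by_cases h : i' ∈ J j₀ <;> simp [h]
  have e3 : T ((J j₀).piecewise w' u) = -b * T ((J j₀).piecewise w u) := by
    rw [hw', ← (J j₀).update_piecewise_of_mem _ _ hi, hT.smul i (mem_univ i)]
    congr 2
    rw [update_eq_iff]
    simp [hi]
  rw [e1, hB, e2, e3] at hadd
  linear_combination -hadd

/-- A multilinear form vanishing on the common zeros of a bounded number of multilinear forms,
each in a proper nonempty subset of the variables, has bounded partition rank. -/
theorem exists_partitionRankLE_of_vanishing (d : ℕ) : ∀ D a b : ℕ, ∃ C : ℕ,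
    ∀ (k V κ : Type) [Field k] [AddCommGroup V] [Module k V] [Fintype κ]
      (J : κ → Finset (Fin d)) (c : κ → (Fin d → V) → k) (T : (Fin d → V) → k),
      (∀ j, IsMultilinearOn (J j) (c j)) → (∀ j, (J j).Nonempty) → (∀ j, J j ≠ univ) →
      Fintype.card κ ≤ b → (∀ j, (J j).card ≤ D) → #{j | (J j).card = D} ≤ a →
      IsMultilinearOn univ T → (∀ u, (∀ j, c j u = 0) → T u = 0) → PartitionRankLE C T := by
  intro D
  induction D with
  | zero =>
    intro a b
    refine ⟨0, fun k V κ _ _ _ _ J c T hc hJ hJ' hb hD ha hT hv => ⟨0, le_rfl, ?_⟩⟩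
    refine ⟨Fin.elim0, Fin.elim0, Fin.elim0, fun t => t.elim0, fun u => ?_⟩
    simpa using hv u fun j => absurd (hD j) (by have := (hJ j).card_pos; omega)
  | succ D ihD =>
    intro a
    induction a with
    | zero =>
      intro b
      obtain ⟨C, hC⟩ := ihD b b
      refine ⟨C, fun k V κ _ _ _ _ J c T hc hJ hJ' hb hD ha hT hv => ?_⟩
      refine hC k V κ J c T hc hJ hJ' hb (fun j => ?_) ((card_le_univ _).trans hb) hT hv
      have h1 := hD j
      have h2 : j ∉ ({j | (J j).card = D + 1} : Finset κ) := by
        rw [card_eq_zero.1 (Nat.le_zero.1 ha)]; simp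
      simp at h2
      omega
    | succ a iha =>
      intro b
      obtain ⟨C₁, hC₁⟩ := iha b
      obtain ⟨C₂, hC₂⟩ := iha (b + b * 2 ^ d)
      refine ⟨max C₁ (C₂ + 1), fun k V κ _ _ _ _ J c T hc hJ hJ' hb hD ha hT hv => ?_⟩
      classical
      by_cases hex : ∃ j, (J j).card = D + 1
      swap
      · refine (hC₁ k V κ J c T hc hJ hJ' hb hD ?_ hT hv).mono (le_max_left _ _)
        rw [filter_false_of_mem fun j _ h => hex ⟨j, h⟩]
        simp
      obtain ⟨j₀, hj₀⟩ := hex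
      have hcard : #{j : {j // j ≠ j₀} | (J j).card = D + 1} ≤ a := by
        have h1 : (({j : {j // j ≠ j₀} | (J j).card = D + 1} : Finset _).map
            (Embedding.subtype _)) ⊆ ({j | (J j).card = D + 1} : Finset κ).erase j₀ := by
          intro j
          simp only [mem_map, mem_filter, mem_univ, true_and, mem_erase]
          rintro ⟨j', h, rfl⟩
          exact ⟨j'.2, h⟩
        have h2 := card_le_card h1
        rw [card_map, card_erase_of_mem (by simp [hj₀])] at h2
        omega
      have hb' : Fintype.card {j // j ≠ j₀} ≤ b := (Fintype.card_subtype_le _).trans hb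
      by_cases hdrop : ∀ u, (∀ j, j ≠ j₀ → c j u = 0) → c j₀ u = 0
      · refine (hC₁ k V {j // j ≠ j₀} (fun j => J j) (fun j => c j) T (fun j => hc j)
          (fun j => hJ j) (fun j => hJ' j) hb' (fun j => hD j) hcard hT fun u hu => ?_).mono
          (le_max_left _ _)
        have h1 : ∀ j, j ≠ j₀ → c j u = 0 := fun j hj => hu ⟨j, hj⟩
        refine hv u fun j => ?_
        rcases eq_or_ne j j₀ with rfl | hj
        · exact hdrop u h1
        · exact h1 j hj
      push Not at hdrop
      obtain ⟨w, hw₁, hw₀⟩ := hdrop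
      obtain ⟨w, hw, hw₀, hw₁⟩ : ∃ w : Fin d → V, (∀ i ∉ J j₀, w i = 0) ∧ c j₀ w = 1 ∧
          ∀ j ≠ j₀, c j w = 0 := by
        obtain ⟨i, hi⟩ := hJ j₀
        set w₁ := (J j₀).piecewise w 0 with hw₁def
        have h0 : c j₀ w₁ = c j₀ w := (hc j₀).congr _ _ fun i hi => by simp [hw₁def, hi]
        have h1 : ∀ j ≠ j₀, c j w₁ = 0 := fun j hj => by
          by_cases hs : J j ⊆ J j₀
          · rw [← hw₁ j hj]
            exact (hc j).congr _ _ fun i hi => by simp [hw₁def, hs hi]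
          · obtain ⟨i', hi', hi''⟩ := not_subset.1 hs
            exact (hc j).eq_zero hi' (by simp [hw₁def, hi''])
        refine ⟨update w₁ i ((c j₀ w)⁻¹ • w₁ i), fun i' hi' => ?_, ?_, fun j hj => ?_⟩
        · have : i' ≠ i := fun e => hi' (e ▸ hi)
          simp [this, hw₁def, hi']
        · rw [(hc j₀).smul i hi, update_eq_self, h0, inv_mul_cancel₀ hw₀]
        · have := (hc j).piecewise_update_smul_eq_zero (s := ∅) (u := w₁) (w := w₁)
            (by rw [piecewise_empty]; exact h1 j hj) i ((c j₀ w)⁻¹)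
          rwa [piecewise_empty] at this
      have hg : IsMultilinearOn (J j₀)ᶜ (fun u => T ((J j₀).piecewise w u)) := by
        have := hT.piecewise (J j₀)ᶜ w
        simpa [piecewise_compl] using this
      have hfg := (hc j₀).mul hg disjoint_compl_right
      rw [union_compl] at hfg
      refine PartitionRankLE.mono ?_ (le_max_right _ _)
      refine PartitionRankLE.of_sub_mul (hJ j₀) (hJ' j₀) (hc j₀) hg ?_
      let M := {p : κ × Finset (Fin d) // (J p.1 ∩ p.2).Nonempty ∧ ¬ J p.1 ⊆ p.2}
      have hlt : ∀ p : M, (J p.1.1 ∩ p.1.2).card < (J p.1.1).card := fun p =>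
        card_lt_card ⟨inter_subset_left, fun h => p.2.2 fun i hi => (mem_inter.1 (h hi)).2⟩
      refine hC₂ k V ({j // j ≠ j₀} ⊕ M) (Sum.elim (fun j => J j) fun p => J p.1.1 ∩ p.1.2)
        (Sum.elim (fun j => c j) fun p u => c p.1.1 (p.1.2.piecewise u w)) _ ?_ ?_ ?_ ?_ ?_ ?_
        (hT.sub hfg) ?_
      · rintro (j | p)
        · exact hc j
        · exact (hc p.1.1).piecewise _ _
      · rintro (j | p)
        · exact hJ j
        · exact p.2.1
      · rintro (j | p)
        · exact hJ' j
        · intro h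
          refine p.2.2 fun i _ => ?_
          have : i ∈ J p.1.1 ∩ p.1.2 := by
            rw [show J p.1.1 ∩ p.1.2 = univ from h]; exact mem_univ i
          exact (mem_inter.1 this).2
      · rw [Fintype.card_sum]
        refine add_le_add hb' ((Fintype.card_subtype_le _).trans ?_)
        rw [Fintype.card_prod, Fintype.card_finset, Fintype.card_fin]
        exact Nat.mul_le_mul_right _ hb
      · rintro (j | p)
        · exact hD j
        · exact (hlt p).le.trans (hD _)
      · refine le_trans ?_ hcard
        rw [← card_map (Embedding.inl : {j // j ≠ j₀} ↪ {j // j ≠ j₀} ⊕ M)]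
        refine card_le_card ?_
        rintro (j | p) hp
        · simpa using hp
        · have h1 := hlt p
          have h2 := hD p.1.1
          simp at hp
          omega
      · intro u hu
        exact sub_mul_eq_zero_of_mixed hc hJ hT hv j₀ hw hw₀ hw₁
          (fun j hj => hu (Sum.inl ⟨j, hj⟩)) fun j s h1 h2 => hu (Sum.inr ⟨(j, s), h1, h2⟩)

/-- A multilinear form of large partition rank restricts to arbitrary tensors of bounded size. -/
theorem exists_realization (d : ℕ) (hd : 0 < d) (N : ℕ) : ∃ C : ℕ,
    ∀ (k V Λ : Type) [Field k] [AddCommGroup V] [Module k V] [Fintype Λ]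
      (T : (Fin d → V) → k), Fintype.card Λ ≤ N → IsMultilinearOn univ T →
      ¬ PartitionRankLE C T → ∀ F : (Fin d → Λ) → k,
        ∃ v : Fin d → Λ → V, ∀ l, T (fun i => v i (l i)) = F l := by
  obtain ⟨C, hC⟩ := exists_partitionRankLE_of_vanishing d d (2 ^ d * N ^ d) (2 ^ d * N ^ d)
  refine ⟨C, fun k V Λ _ _ _ _ T hN hT hC' F => ?_⟩
  classical
  have hne : (univ : Finset (Fin d)).Nonempty := ⟨⟨0, hd⟩, mem_univ _⟩
  suffices H : ∀ (S : Finset (Fin d → Λ)) (F : (Fin d → Λ) → k), (∀ l ∉ S, F l = 0) →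
      ∃ v : Fin d → Λ → V, ∀ l, T (fun i => v i (l i)) = F l from H univ F (by simp)
  intro S
  induction S using Finset.induction_on with
  | empty =>
    intro F hF
    exact ⟨0, fun l => by rw [hF l (by simp)]; exact hT.eq_zero (mem_univ ⟨0, hd⟩) rfl⟩
  | insert l₀ S hl₀ ih =>
    intro F hF
    obtain ⟨v, hv⟩ := ih (update F l₀ 0) fun l hl => by
      rcases eq_or_ne l l₀ with rfl | h
      · simp
      · rw [update_of_ne h]
        exact hF l (by simp [h, hl])
    let κ := {p : Finset (Fin d) × (Fin d → Λ) // p.1.Nonempty ∧ p.1 ≠ univ}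
    let c : κ → (Fin d → V) → k := fun p u => T (p.1.1.piecewise u fun i => v i (p.1.2 i))
    have hc : ∀ p : κ, IsMultilinearOn p.1.1 (c p) := fun p => by
      have := hT.piecewise p.1.1 fun i => v i (p.1.2 i)
      rwa [univ_inter] at this
    have hκ : Fintype.card κ ≤ 2 ^ d * N ^ d := by
      refine (Fintype.card_subtype_le _).trans ?_
      rw [Fintype.card_prod, Fintype.card_finset, Fintype.card_fun, Fintype.card_fin]
      exact Nat.mul_le_mul_left _ (Nat.pow_le_pow_left hN d)
    obtain ⟨u, hu, hTu⟩ : ∃ u, (∀ p, c p u = 0) ∧ T u ≠ 0 := by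
      by_contra! h
      exact hC' (hC k V κ (fun p => p.1.1) c T hc (fun p => p.2.1) (fun p => p.2.2) hκ
        (fun p => (card_le_univ _).trans (by simp)) ((card_le_univ _).trans hκ) hT h)
    obtain ⟨u, hu, hTu⟩ : ∃ u, (∀ p, c p u = 0) ∧ T u = F l₀ := by
      refine ⟨update u ⟨0, hd⟩ ((F l₀ / T u) • u ⟨0, hd⟩), fun p => ?_, ?_⟩
      · have := (hc p).piecewise_update_smul_eq_zero (s := ∅) (u := u) (w := u)
          (by rw [piecewise_empty]; exact hu p) ⟨0, hd⟩ (F l₀ / T u)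
        rwa [piecewise_empty] at this
      · rw [hT.smul _ (mem_univ _), update_eq_self, div_mul_cancel₀ _ hTu]
    refine ⟨fun i a => (if a = l₀ i then u i else 0) + v i a, fun l => ?_⟩
    have hmix : ∀ s : Finset (Fin d), (univ ∩ s).Nonempty → ¬ univ ⊆ s →
        T (s.piecewise (fun i => if l i = l₀ i then u i else 0) fun i => v i (l i)) = 0 := by
      intro s h1 h2
      rw [univ_inter] at h1
      by_cases h : ∀ i ∈ s, l i = l₀ i
      · rw [← hu ⟨(s, l), h1, fun e => h2 (by simp [show s = univ from e])⟩]
        refine congrArg T ?_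
        ext i
        by_cases hi : i ∈ s
        · simp [hi, h i hi]
        · simp [hi]
      · push Not at h
        obtain ⟨i, hi, hi'⟩ := h
        exact hT.eq_zero (mem_univ i) (by simp [hi, hi'])
    have := hT.map_add_of_mixed_eq_zero hne _ _ hmix
    refine this.trans ?_
    rw [hv]
    rcases eq_or_ne l l₀ with rfl | h
    · simp [hTu]
    · rw [update_of_ne h]
      obtain ⟨i, hi⟩ := Function.ne_iff.1 h
      rw [hT.eq_zero (mem_univ i) (by simp [hi]), zero_add]

/-- A family of functionals on `Y → k` indexed by `X`, depending on fewer than `|X|` parameters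
that are read off from a matrix, cannot annihilate the rows of every matrix. -/
theorem exists_sum_mul_ne_zero {k X Y E : Type*} [Field k] [Fintype k] [Fintype X] [Fintype Y]
    [Fintype E] (hE : Fintype.card E < Fintype.card X) (D : (X → Y → k) → E → k)
    (Φ : (E → k) → X → Y → k) (hΦ : ∀ D x, ∃ y, Φ D x y ≠ 0) :
    ∃ F x, ∑ y, Φ (D F) x y * F x y ≠ 0 := by
  classical
  by_contra! H
  choose a ha using hΦ
  let ψ : (X → k) × (X → Y → k) → (E → k) × (X → Y → k) := fun p =>
    (D p.2, fun x y => p.2 x y + if y = a (D p.2) x then p.1 x else 0)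
  have hψ : Injective ψ := by
    rintro ⟨h, F⟩ ⟨h', F'⟩ e
    obtain ⟨e₁, e₂⟩ := Prod.mk.inj e
    have e₁ : D F = D F' := e₁
    have e₂ : ∀ x y, F x y + (if y = a (D F) x then h x else 0) =
      F' x y + if y = a (D F') x then h' x else 0 := fun x y => congrFun (congrFun e₂ x) y
    have hh : h = h' := by
      ext x
      have e₃ : ∑ y, Φ (D F) x y * (F x y + if y = a (D F) x then h x else 0) =
          ∑ y, Φ (D F') x y * (F' x y + if y = a (D F') x then h' x else 0) :=
        sum_congr rfl fun y _ => by rw [e₂, e₁]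
      simp only [mul_add, sum_add_distrib, H, mul_ite, mul_zero, sum_ite_eq', mem_univ, if_true,
        zero_add] at e₃
      rw [e₁] at e₃
      exact mul_left_cancel₀ (ha _ _) e₃
    subst hh
    refine Prod.ext rfl ?_
    ext x y
    have := e₂ x y
    rwa [e₁, add_left_inj] at this
  have hcard := Fintype.card_le_of_injective ψ hψ
  rw [Fintype.card_prod, Fintype.card_prod] at hcard
  have h1 := Nat.le_of_mul_le_mul_right hcard Fintype.card_pos
  rw [Fintype.card_fun, Fintype.card_fun] at h1
  exact absurd ((Nat.pow_le_pow_iff_right Fintype.one_lt_card).1 h1) (not_le.2 hE)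

/-- Chevalley–Warning: few forms without constant term in many variables have a nontrivial common
zero. -/
theorem exists_ne_zero_forall_eval_eq_zero {k τ ι : Type*} [Field k] [Finite k] [Fintype τ]
    [Fintype ι] (d : ℕ) (f : ι → MvPolynomial τ k) (hf : ∀ i, (f i).totalDegree ≤ d)
    (h0 : ∀ i, MvPolynomial.eval 0 (f i) = 0) (hcard : Fintype.card ι * d < Fintype.card τ) :
    ∃ y : τ → k, y ≠ 0 ∧ ∀ i, MvPolynomial.eval y (f i) = 0 := by
  classical
  have := Fintype.ofFinite k
  obtain ⟨p, hp⟩ := CharP.exists k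
  have hp' : p.Prime := (CharP.char_is_prime_or_zero k p).resolve_right
    (CharP.char_ne_zero_of_finite k p)
  have := char_dvd_card_solutions_of_fintype_sum_lt p (f := f)
    (lt_of_le_of_lt ((sum_le_sum fun i _ => hf i).trans (by simp)) hcard)
  by_contra! H
  have hs : ∀ y : {x : τ → k // ∀ i, MvPolynomial.eval x (f i) = 0}, y.1 = 0 := by
    rintro ⟨y, hy⟩
    by_contra h
    obtain ⟨i, hi⟩ := H y h
    exact hi (hy i)
  have h1 : Fintype.card {x : τ → k // ∀ i, MvPolynomial.eval x (f i) = 0} = 1 :=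
    Fintype.card_eq_one_iff.2 ⟨⟨0, h0⟩, fun y => Subtype.ext (hs y)⟩
  rw [h1] at this
  exact hp'.one_lt.ne' (Nat.dvd_one.1 this)

/-- The symmetrisation of `T` along `E`. -/
def symmetrize {k V V' : Type*} [Field k] [AddCommGroup V] [Module k V] [AddCommGroup V']
    [Module k V'] {d : ℕ} (T : MultilinearMap k (fun _ : Fin d => V') k) (E : V →ₗ[k] V')
    (u : Fin d → V) : k :=
  ∑ σ : Equiv.Perm (Fin d), T fun j => E (u (σ j))

theorem isMultilinearOn_symmetrize {k V V' : Type*} [Field k] [AddCommGroup V] [Module k V]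
    [AddCommGroup V'] [Module k V'] {d : ℕ} (T : MultilinearMap k (fun _ : Fin d => V') k)
    (E : V →ₗ[k] V') : IsMultilinearOn univ (symmetrize T E) := by
  have e : ∀ (σ : Equiv.Perm (Fin d)) (i : Fin d) (u : Fin d → V) (x : V),
      (fun j => E (update u i x (σ j))) = update (fun j => E (u (σ j))) (σ.symm i) (E x) := by
    intro σ i u x
    ext j
    by_cases h : σ j = i
    · subst h; simp
    · have : j ≠ σ.symm i := by rintro rfl; simp at h
      simp [h, this]
  refine ⟨fun i _ u x y => ?_, fun i _ u a x => ?_, fun u v h => ?_⟩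
  · simp only [symmetrize, e, map_add, MultilinearMap.map_update_add, sum_add_distrib]
  · simp only [symmetrize, e, map_smul, MultilinearMap.map_update_smul, smul_eq_mul, mul_sum]
  · rw [show u = v from funext fun i => h i (mem_univ i)]

theorem exists_symmetrize_ne_zero (d M : ℕ) (hd : 0 < d) : ∃ C : ℕ,
    ∀ (k V V' B : Type) [Field k] [Finite k] [AddCommGroup V] [Module k V] [AddCommGroup V']
      [Module k V'] [Fintype B] (T : MultilinearMap k (fun _ : Fin d => V') k) (E : V →ₗ[k] V'),
      Fintype.card B ≤ M → ¬ PartitionRankLE C (symmetrize T E) → ∀ W : B → V',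
      ∃ u : Fin d → V, symmetrize T E u ≠ 0 ∧ ∀ ρ : Fin d → Fin d ⊕ B,
        (∃ i j, ρ j = Sum.inl i) → (∃ i, ∀ j, ρ j ≠ Sum.inl i) →
        T (fun j => Sum.elim (fun i => E (u i)) W (ρ j)) = 0 := by
  set N := (d + M) ^ d with hN
  set A := N * d + 1 with hA
  set L := N * A ^ d + 1 with hL
  obtain ⟨C, hC⟩ := exists_realization d hd (L * A)
  refine ⟨C, fun k V V' B _ _ _ _ _ _ _ T E hB hC' W => ?_⟩
  classical
  have := Fintype.ofFinite k
  let Bad := {ρ : Fin d → Fin d ⊕ B // (∃ i j, ρ j = Sum.inl i) ∧ ∃ i, ∀ j, ρ j ≠ Sum.inl i}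
  have hBad : Fintype.card Bad ≤ N := by
    refine (Fintype.card_subtype_le _).trans ?_
    rw [Fintype.card_fun, Fintype.card_sum, Fintype.card_fin]
    exact Nat.pow_le_pow_left (by omega) d
  choose i₀ hi₀ using fun ρ : Bad => ρ.2.2
  let I := Σ ρ : Bad, ({i // i ≠ i₀ ρ} → Fin L) × (Fin d → Fin A)
  have hI : Fintype.card I < Fintype.card (Fin d → Fin L) := by
    have h1 : Fintype.card I = Fintype.card Bad * (L ^ (d - 1) * A ^ d) := by
      simp [I, Fintype.card_sigma]
    rw [h1, Fintype.card_fun, Fintype.card_fin, Fintype.card_fin]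
    calc Fintype.card Bad * (L ^ (d - 1) * A ^ d) ≤ N * (L ^ (d - 1) * A ^ d) :=
          Nat.mul_le_mul_right _ hBad
      _ = L ^ (d - 1) * (N * A ^ d) := by ring
      _ < L ^ (d - 1) * L := Nat.mul_lt_mul_of_pos_left (by omega) (by positivity)
      _ = L ^ d := by rw [← pow_succ]; congr 1; omega
  have hreal : ∀ F : (Fin d → Fin L) → (Fin d → Fin A) → k, ∃ v : Fin d → Fin L × Fin A → V,
      ∀ l a, symmetrize T E (fun i => v i (l i, a i)) = F l a := by
    intro F
    obtain ⟨v, hv⟩ := hC k V (Fin L × Fin A) (symmetrize T E) (by simp)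
      (isMultilinearOn_symmetrize T E) hC' fun x => F (fun i => (x i).1) fun i => (x i).2
    exact ⟨v, fun l a => hv fun i => (l i, a i)⟩
  choose v hv using hreal
  let res : (Fin d → Fin L) → ∀ ρ : Bad, {i // i ≠ i₀ ρ} → Fin L := fun l ρ i => l i
  let fill : ∀ ρ : Bad, ({i // i ≠ i₀ ρ} → Fin L) → Fin d → Fin L := fun ρ l i =>
    if h : i ≠ i₀ ρ then l ⟨i, h⟩ else 0
  let vec : (Fin d → Fin L × Fin A → V) → (Fin d → Fin L) → Fin d ⊕ B → Fin A → V' :=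
    fun v l t a => Sum.elim (fun i => E (v i (l i, a))) (fun b => if a = 0 then W b else 0) t
  let D : ((Fin d → Fin L) → (Fin d → Fin A) → k) → I → k := fun F x =>
    T fun j => vec (v F) (fill x.1 x.2.1) (x.1.1 j) (x.2.2 j)
  let co : Fin d ⊕ B → k → k := Sum.elim (fun _ z => z) fun _ _ => 1
  have hy : ∀ (D : I → k) (l : Fin d → Fin L), ∃ y : Fin A → k, y ≠ 0 ∧ ∀ ρ : Bad,
      ∑ a : Fin d → Fin A, D ⟨ρ, res l ρ, a⟩ * ∏ j, co (ρ.1 j) (y (a j)) = 0 := by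
    intro D l
    let co' : Fin d ⊕ B → Fin A → MvPolynomial (Fin A) k :=
      Sum.elim (fun _ a => MvPolynomial.X a) fun _ _ => 1
    have hco : ∀ t a y, MvPolynomial.eval y (co' t a) = co t (y a) := by
      rintro (i | b) a y <;> simp [co, co']
    have heval : ∀ (ρ : Bad) y, MvPolynomial.eval y (∑ a : Fin d → Fin A,
        MvPolynomial.C (D ⟨ρ, res l ρ, a⟩) * ∏ j, co' (ρ.1 j) (a j)) =
        ∑ a : Fin d → Fin A, D ⟨ρ, res l ρ, a⟩ * ∏ j, co (ρ.1 j) (y (a j)) := by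
      intro ρ y
      simp [hco, map_sum, map_prod]
    have key := exists_ne_zero_forall_eval_eq_zero d
      (fun ρ : Bad => ∑ a : Fin d → Fin A,
        MvPolynomial.C (D ⟨ρ, res l ρ, a⟩) * ∏ j, co' (ρ.1 j) (a j))
    simp only [heval] at key
    refine key ?_ ?_ ?_
    · intro ρ
      refine MvPolynomial.totalDegree_finsetSum_le fun a _ => ?_
      refine (MvPolynomial.totalDegree_mul _ _).trans ?_
      rw [MvPolynomial.totalDegree_C, zero_add]
      refine (MvPolynomial.totalDegree_finsetProd _ _).trans ?_
      refine (sum_le_card_nsmul _ _ 1 fun j _ => ?_).trans (by simp)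
      rcases ρ.1 j with i | b <;> simp [co']
    · intro ρ
      obtain ⟨i, j, hj⟩ := ρ.2.1
      refine sum_eq_zero fun a _ => ?_
      rw [prod_eq_zero (mem_univ j) (by simp [co, hj]), mul_zero]
    · rw [Fintype.card_fin]
      exact Nat.lt_succ_of_le (Nat.mul_le_mul_right d hBad)
  choose y hy0 hy using hy
  obtain ⟨F, l, hF⟩ := exists_sum_mul_ne_zero hI D (fun D l a => ∏ i, y D l (a i)) fun D l => by
    obtain ⟨a, ha⟩ := Function.ne_iff.1 (hy0 D l)
    exact ⟨fun _ => a, prod_ne_zero_iff.2 fun _ _ => ha⟩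
  set z := y (D F) l with hz
  let u : Fin d → V := fun i => ∑ a, z a • v F i (l i, a)
  have hexp : ∀ ρ : Fin d → Fin d ⊕ B, T (fun j => Sum.elim (fun i => E (u i)) W (ρ j)) =
      ∑ a : Fin d → Fin A, (∏ j, co (ρ j) (z (a j))) * T fun j => vec (v F) l (ρ j) (a j) := by
    intro ρ
    have h1 : (fun j => Sum.elim (fun i => E (u i)) W (ρ j)) =
        fun j => ∑ a : Fin A, co (ρ j) (z a) • vec (v F) l (ρ j) a := by
      ext j
      rcases ρ j with i | b <;> simp [co, vec, u, map_sum]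
    rw [h1, T.map_sum]
    exact sum_congr rfl fun a _ => T.map_smul_univ _ _
  refine ⟨u, ?_, fun ρ h1 h2 => ?_⟩
  · convert hF using 1
    simp only [symmetrize]
    have h2 : ∀ σ : Equiv.Perm (Fin d), T (fun j => E (u (σ j))) =
        ∑ a : Fin d → Fin A, (∏ i, z (a i)) * T fun j => E (v F (σ j) (l (σ j), a (σ j))) := by
      intro σ
      refine (hexp fun j => Sum.inl (σ j)).trans ?_
      refine (Fintype.sum_equiv (σ.arrowCongr (Equiv.refl (Fin A))) _ _ fun a => ?_)
      simp only [co, vec, Sum.elim_inl, Equiv.arrowCongr_apply, Equiv.coe_refl, comp_apply, id,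
        Equiv.symm_apply_apply]
      rw [Equiv.prod_comp σ.symm fun i => z (a i)]
    simp only [h2]
    rw [sum_comm]
    refine sum_congr rfl fun a _ => ?_
    rw [← hv F l a, symmetrize, mul_sum]
  · rw [hexp, ← hy (D F) l ⟨ρ, h1, h2⟩]
    refine sum_congr rfl fun a _ => ?_
    rw [mul_comm]
    congr 1
    refine congrArg T ?_
    ext j
    rcases h : ρ j with i | b
    · have : i ≠ i₀ ⟨ρ, h1, h2⟩ := fun e => hi₀ ⟨ρ, h1, h2⟩ j (by rw [← e]; exact h)
      simp [vec, fill, res, h, this]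
    · simp [vec, h]

/-- The homogeneous coordinates: the variables together with `1`. -/
noncomputable def homCoord {k σ : Type*} [CommSemiring k] : Option σ → MvPolynomial σ k :=
  fun x => x.elim 1 MvPolynomial.X

theorem totalDegree_homCoord_le {k σ : Type*} [CommSemiring k] [Nontrivial k] (x : Option σ) :
    (homCoord x : MvPolynomial σ k).totalDegree ≤ if x = none then 0 else 1 := by
  cases x <;> simp [homCoord]

theorem exists_prod_homCoord_eq {k σ : Type*} [CommSemiring k] (d : ℕ) : ∀ s : σ →₀ ℕ,
    s.degree ≤ d → ∃ φ : Fin d → Option σ,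
      ∏ j, homCoord (φ j) = (MvPolynomial.monomial s 1 : MvPolynomial σ k) := by
  induction d with
  | zero =>
    intro s hs
    rw [Nat.le_zero, Finsupp.degree_eq_zero_iff] at hs
    exact ⟨Fin.elim0, by simp [hs]⟩
  | succ d ih =>
    intro s hs
    by_cases h : s = 0
    · exact ⟨fun _ => none, by simp [h, homCoord]⟩
    · obtain ⟨i, hi⟩ := Finsupp.ne_iff.1 h
      have e : Finsupp.single i 1 + (s - Finsupp.single i 1) = s := by
        refine add_tsub_cancel_of_le (Finsupp.single_le_iff.2 ?_)
        exact Nat.one_le_iff_ne_zero.2 hi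
      obtain ⟨φ, hφ⟩ := ih (s - Finsupp.single i 1) (by
        rw [← e, map_add, Finsupp.degree_single] at hs
        omega)
      refine ⟨Fin.cons (some i) φ, ?_⟩
      rw [Fin.prod_univ_succ]
      simp only [Fin.cons_zero, Fin.cons_succ, hφ]
      rw [homCoord, Option.elim_some, MvPolynomial.X, MvPolynomial.monomial_mul, e, one_mul]

theorem exists_eq_sum_prod_homCoord {k σ : Type*} [CommSemiring k] [Fintype σ] {d : ℕ}
    (P : MvPolynomial σ k) (hP : P.totalDegree ≤ d) : ∃ a : (Fin d → Option σ) → k,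
      P = ∑ φ, MvPolynomial.C (a φ) * ∏ j, homCoord (φ j) := by
  classical
  have h : ∀ s : σ →₀ ℕ, ∃ φ : Fin d → Option σ, s ∈ P.support →
      ∏ j, homCoord (φ j) = (MvPolynomial.monomial s 1 : MvPolynomial σ k) := by
    intro s
    by_cases hs : s ∈ P.support
    · obtain ⟨φ, hφ⟩ := exists_prod_homCoord_eq (k := k) d s
        (le_trans (MvPolynomial.le_totalDegree hs) hP)
      exact ⟨φ, fun _ => hφ⟩
    · exact ⟨fun _ => none, fun h => absurd h hs⟩
  choose φ hφ using h
  refine ⟨fun ψ => ∑ s ∈ P.support with φ s = ψ, P.coeff s, ?_⟩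
  simp only [map_sum, sum_mul, sum_filter]
  rw [sum_comm]
  conv_lhs => rw [P.as_sum]
  refine sum_congr rfl fun s hs => ?_
  simp only [apply_ite MvPolynomial.C, map_zero, ite_mul, zero_mul, sum_ite_eq, mem_univ, if_true]
  rw [hφ s hs, MvPolynomial.C_mul_monomial, mul_one]

/-- The multilinear form with coefficients `a`. -/
noncomputable def coeffForm {k β : Type*} [Field k] [Fintype β] {d : ℕ} (a : (Fin d → β) → k) :
    MultilinearMap k (fun _ : Fin d => β → k) k :=
  ∑ φ, a φ • (MultilinearMap.mkPiAlgebra k (Fin d) k).compLinearMap fun j => LinearMap.proj (φ j)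

theorem coeffForm_apply {k β : Type*} [Field k] [Fintype β] {d : ℕ} (a : (Fin d → β) → k)
    (x : Fin d → β → k) : coeffForm a x = ∑ φ, a φ * ∏ j, x j (φ j) := by
  simp [coeffForm]

/-- Multilinear expansion with polynomial coefficients. -/
theorem sum_mul_prod_sum_eq {k β τ R : Type*} [Field k] [CommRing R] [Algebra k R] [Fintype β]
    [Fintype τ] {d : ℕ} (a : (Fin d → β) → k) (r : τ → R) (v : τ → β → k) :
    ∑ φ : Fin d → β, algebraMap k R (a φ) * ∏ j, ∑ t, r t * algebraMap k R (v t (φ j)) =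
      ∑ ρ : Fin d → τ, (∏ j, r (ρ j)) * algebraMap k R (coeffForm a fun j => v (ρ j)) := by
  classical
  simp only [prod_univ_sum, Fintype.piFinset_univ, coeffForm_apply, map_sum, map_mul, map_prod,
    mul_sum]
  rw [sum_comm]
  refine sum_congr rfl fun ρ _ => sum_congr rfl fun φ _ => ?_
  rw [prod_mul_distrib]
  ring

/-- Extension of a vector by zero to homogeneous coordinates. -/
def extendZero (k σ : Type*) [Field k] : (σ → k) →ₗ[k] (Option σ → k) where
  toFun u x := x.elim 0 u
  map_add' u v := by ext x; cases x <;> simp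
  map_smul' a u := by ext x; cases x <;> simp

theorem exists_sum_mul_of_partitionRankLE {k : Type*} [Field k] {d n r : ℕ}
    {T : (Fin d → Fin n → k) → k} (hT : PartitionRankLE r T) :
    ∃ s ≤ r, ∃ Q R : Fin s → MvPolynomial (Fin n) k,
      (∀ t, (Q t).totalDegree < d ∧ (R t).totalDegree < d) ∧
      ∑ ψ : Fin d → Fin n, MvPolynomial.C (T fun j => Pi.single (ψ j) 1) *
        ∏ j, MvPolynomial.X (ψ j) = ∑ t, Q t * R t := by
  classical
  obtain ⟨s, hs, J, f, g, h, e⟩ := hT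
  let poly : Finset (Fin d) → ((Fin d → Fin n → k) → k) → MvPolynomial (Fin n) k := fun J f =>
    ∑ ψ : {i // i ∈ J} → Fin n,
      MvPolynomial.C (f fun i => if h : i ∈ J then Pi.single (ψ ⟨i, h⟩) 1 else 0) *
        ∏ i, MvPolynomial.X (ψ i)
  have hdeg : ∀ J f, (poly J f).totalDegree ≤ J.card := fun J f => by
    refine MvPolynomial.totalDegree_finsetSum_le fun ψ _ => ?_
    refine (MvPolynomial.totalDegree_mul _ _).trans ?_
    rw [MvPolynomial.totalDegree_C, zero_add]
    refine (MvPolynomial.totalDegree_finsetProd _ _).trans ?_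
    simp
  have hprod : ∀ (J : Finset (Fin d)) (f g : (Fin d → Fin n → k) → k), IsMultilinearOn J f →
      IsMultilinearOn Jᶜ g → ∑ ψ : Fin d → Fin n, MvPolynomial.C
        ((f fun j => Pi.single (ψ j) 1) * g fun j => Pi.single (ψ j) 1) *
          ∏ j, MvPolynomial.X (ψ j) = poly J f * poly Jᶜ g := by
    intro J f g hf hg
    let E : ((Fin d → Fin n)) ≃ ({i // i ∈ J} → Fin n) × ({i // i ∈ Jᶜ} → Fin n) :=
      (Equiv.piEquivPiSubtypeProd (· ∈ J) fun _ => Fin n).trans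
        ((Equiv.refl _).prodCongr
          (Equiv.arrowCongr (Equiv.subtypeEquivRight (by simp)) (Equiv.refl _)))
    simp only [poly]
    rw [Fintype.sum_mul_sum, ← Fintype.sum_prod_type']
    refine Fintype.sum_equiv E _ _ fun ψ => ?_
    have e1 : ∀ i, (E ψ).1 i = ψ i := fun i => rfl
    have e2 : ∀ i, (E ψ).2 i = ψ i := fun i => rfl
    simp only [e1, e2]
    rw [hf.congr (fun j => Pi.single (ψ j) 1) (fun i => if h : i ∈ J then Pi.single (ψ i) 1 else 0)
        (fun i hi => by simp [hi]),
      hg.congr (fun j => Pi.single (ψ j) 1) (fun i => if h : i ∈ Jᶜ then Pi.single (ψ i) 1 else 0)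
        (fun i hi => by simp [mem_compl.1 hi]), map_mul,
      ← prod_mul_prod_compl J fun j => (MvPolynomial.X (ψ j) : MvPolynomial (Fin n) k),
      ← prod_coe_sort J, ← prod_coe_sort Jᶜ]
    ring
  refine ⟨s, hs, fun t => poly (J t) (f t), fun t => poly (J t)ᶜ (g t), fun t => ⟨?_, ?_⟩, ?_⟩
  · refine (hdeg _ _).trans_lt ?_
    have := card_lt_univ_of_notMem
      (s := J t) (x := (not_forall.1 fun h' => (h t).2.1 (eq_univ_iff_forall.2 h')).choose)
      (not_forall.1 fun h' => (h t).2.1 (eq_univ_iff_forall.2 h')).choose_spec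
    simpa using this
  · refine (hdeg _ _).trans_lt ?_
    have := (h t).1.card_pos
    rw [card_compl, Fintype.card_fin]
    have := card_le_univ (J t)
    rw [Fintype.card_fin] at this
    omega
  · simp only [e, map_sum, sum_mul]
    rw [sum_comm]
    exact sum_congr rfl fun t _ => hprod _ _ _ (h t).2.2.1 (h t).2.2.2

theorem schmidtRank_le_of_partitionRankLE {k : Type*} [Field k] {d n C : ℕ} (hd : 0 < d)
    (hk : (d.factorial : k) ≠ 0) (a : (Fin d → Option (Fin n)) → k)
    (h : PartitionRankLE C (symmetrize (coeffForm a) (extendZero k (Fin n)))) :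
    schmidtRank d (∑ φ, MvPolynomial.C (a φ) * ∏ j, homCoord (φ j)) ≤ C + 1 := by
  classical
  obtain ⟨s, hs, Q, R, hQR, e⟩ := exists_sum_mul_of_partitionRankLE h
  set top : MvPolynomial (Fin n) k :=
    ∑ ψ : Fin d → Fin n, MvPolynomial.C (a fun j => some (ψ j)) * ∏ j, MvPolynomial.X (ψ j)
    with htop
  have hcoeff : ∀ ψ : Fin d → Fin n,
      coeffForm a (fun j => extendZero k (Fin n) (Pi.single (ψ j) 1)) = a fun j => some (ψ j) := by
    intro ψ
    rw [coeffForm_apply, sum_eq_single fun j => some (ψ j)]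
    · simp [extendZero]
    · intro φ _ hφ
      obtain ⟨j, hj⟩ := Function.ne_iff.1 hφ
      rw [prod_eq_zero (mem_univ j), mul_zero]
      cases h : φ j with
      | none => simp [extendZero]
      | some i =>
        have : i ≠ ψ j := by rintro rfl; exact hj h
        simp [extendZero, this]
    · simp
  have hsym : ∑ ψ : Fin d → Fin n, MvPolynomial.C (symmetrize (coeffForm a)
      (extendZero k (Fin n)) fun j => Pi.single (ψ j) 1) * ∏ j, MvPolynomial.X (ψ j) =
      MvPolynomial.C (d.factorial : k) * top := by
    simp only [symmetrize, hcoeff, map_sum, sum_mul]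
    rw [sum_comm]
    have : ∀ σ : Equiv.Perm (Fin d), ∑ ψ : Fin d → Fin n,
        MvPolynomial.C (a fun j => some (ψ (σ j))) * ∏ j, MvPolynomial.X (ψ j) = top := by
      intro σ
      refine Fintype.sum_equiv (σ.symm.arrowCongr (Equiv.refl (Fin n))) _ _ fun ψ => ?_
      simp only [Equiv.arrowCongr_apply, Equiv.symm_symm, Equiv.coe_refl, comp_apply, id]
      rw [Equiv.prod_comp σ fun j => (MvPolynomial.X (ψ j) : MvPolynomial (Fin n) k)]
    rw [sum_congr rfl fun σ _ => this σ, sum_const, card_univ, Fintype.card_perm, Fintype.card_fin,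
      nsmul_eq_mul, map_natCast]
  have hlow : (∑ φ, MvPolynomial.C (a φ) * ∏ j, homCoord (φ j) - top).totalDegree < d := by
    have e1 : top = ∑ φ : Fin d → Option (Fin n) with ∀ j, φ j ≠ none,
        MvPolynomial.C (a φ) * ∏ j, homCoord (φ j) := by
      rw [htop]
      symm
      refine sum_bij' (fun φ hφ j => (φ j).get (Option.ne_none_iff_isSome.1
        ((mem_filter.1 hφ).2 j))) (fun ψ _ j => some (ψ j)) ?_ ?_ ?_ ?_ ?_
      · simp
      · simp
      · intro φ hφ; simp
      · intro ψ _; simp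
      · intro φ hφ
        simp only [Option.some_get]
        congr 1
        refine prod_congr rfl fun j _ => ?_
        conv_lhs => rw [← Option.some_get (Option.ne_none_iff_isSome.1 ((mem_filter.1 hφ).2 j))]
        rfl
    rw [e1, sub_eq_of_eq_add' (sum_filter_add_sum_filter_not univ
      (fun φ : Fin d → Option (Fin n) => ∀ j, φ j ≠ none) _).symm]
    refine lt_of_le_of_lt (MvPolynomial.totalDegree_finsetSum_le (d := d - 1) fun φ hφ => ?_)
      (by omega)
    refine (MvPolynomial.totalDegree_mul _ _).trans ?_
    rw [MvPolynomial.totalDegree_C, zero_add]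
    refine (MvPolynomial.totalDegree_finsetProd _ _).trans ?_
    obtain ⟨j, hj⟩ := not_forall.1 (mem_filter.1 hφ).2
    rw [not_not] at hj
    rw [← add_sum_erase _ _ (mem_univ j)]
    have h1 := totalDegree_homCoord_le (k := k) (φ j)
    rw [if_pos hj, Nat.le_zero] at h1
    rw [h1, zero_add]
    refine (sum_le_card_nsmul _ _ 1 fun i _ => (totalDegree_homCoord_le _).trans ?_).trans ?_
    · split_ifs <;> simp
    · simp [card_erase_of_mem]
  refine le_trans (Nat.sInf_le (m := s + 1) ?_) (Nat.succ_le_succ hs)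
  refine ⟨Fin.cons (∑ φ, MvPolynomial.C (a φ) * ∏ j, homCoord (φ j) - top)
      (fun t => MvPolynomial.C (d.factorial : k)⁻¹ * Q t), Fin.cons 1 R, ?_, ?_⟩
  · intro t
    refine Fin.cases ?_ (fun t => ?_) t
    · exact ⟨hlow, by simpa using hd⟩
    · refine ⟨?_, (hQR t).2⟩
      refine (MvPolynomial.totalDegree_mul _ _).trans_lt ?_
      rw [MvPolynomial.totalDegree_C, zero_add]
      exact (hQR t).1
  · rw [Fin.sum_univ_succ]
    simp only [Fin.cons_zero, Fin.cons_succ, mul_assoc, ← mul_sum]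
    rw [← e, hsym, ← mul_assoc, ← map_mul, inv_mul_cancel₀ hk]
    simp

/-- Only the terms supported on `B` and the bijective terms survive in the expansion of a form at
vectors whose other mixed evaluations vanish. -/
theorem sum_mul_coeffForm_eq_add {k β B R : Type*} [Field k] [CommRing R] [Algebra k R] [Fintype β]
    [Fintype B] {d : ℕ} (hd : 0 < d) (a : (Fin d → β) → k) (r : Fin d ⊕ B → R)
    (v : Fin d ⊕ B → β → k) (h0 : ∀ ρ : Fin d → Fin d ⊕ B,
      (∃ i j, ρ j = Sum.inl i) → (∃ i, ∀ j, ρ j ≠ Sum.inl i) →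
        coeffForm a (fun j => v (ρ j)) = 0) :
    ∑ ρ : Fin d → Fin d ⊕ B, (∏ j, r (ρ j)) * algebraMap k R (coeffForm a fun j => v (ρ j)) =
      (∑ ρ : Fin d → B, (∏ j, r (Sum.inr (ρ j))) *
        algebraMap k R (coeffForm a fun j => v (Sum.inr (ρ j)))) +
      (∏ i, r (Sum.inl i)) * algebraMap k R
        (∑ σ : Equiv.Perm (Fin d), coeffForm a fun j => v (Sum.inl (σ j))) := by
  classical
  let f₁ : (Fin d → B) ↪ (Fin d → Fin d ⊕ B) :=
    ⟨fun ρ j => Sum.inr (ρ j), fun ρ ρ' h => funext fun j => Sum.inr_injective (congrFun h j)⟩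
  let f₂ : Equiv.Perm (Fin d) ↪ (Fin d → Fin d ⊕ B) :=
    ⟨fun σ j => Sum.inl (σ j), fun σ σ' h => Equiv.ext fun j => Sum.inl_injective (congrFun h j)⟩
  have hdisj : Disjoint (univ.map f₁) (univ.map f₂) := by
    rw [Finset.disjoint_left]
    rintro ρ h₁ h₂
    obtain ⟨ρ₁, -, rfl⟩ := mem_map.1 h₁
    obtain ⟨σ, -, h⟩ := mem_map.1 h₂
    exact Sum.inl_ne_inr (congrFun h ⟨0, hd⟩)
  rw [← sum_subset (subset_univ (univ.map f₁ ∪ univ.map f₂)), sum_union hdisj, sum_map, sum_map]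
  · congr 1
    rw [map_sum, mul_sum]
    refine sum_congr rfl fun σ _ => ?_
    congr 1
    exact Equiv.prod_comp σ fun i => r (Sum.inl i)
  · intro ρ _ hρ
    rw [mem_union, not_or] at hρ
    rw [h0, map_zero, mul_zero]
    · by_contra! h
      refine hρ.1 (mem_map.2 ?_)
      have : ∀ j, ∃ b, ρ j = Sum.inr b := fun j => by
        rcases e : ρ j with i | b
        · exact absurd e (h i j)
        · exact ⟨b, rfl⟩
      choose b hb using this
      exact ⟨b, mem_univ _, funext fun j => (hb j).symm⟩
    · by_contra! h
      refine hρ.2 (mem_map.2 ?_)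
      choose g hg using h
      have hinj : Injective g := fun i i' e => by
        have := (hg i).symm.trans ((congrArg ρ e).trans (hg i'))
        exact Sum.inl_injective this
      let σ := Equiv.ofBijective g (Finite.injective_iff_bijective.1 hinj)
      refine ⟨σ.symm, mem_univ _, funext fun j => ?_⟩
      have := hg (σ.symm j)
      rw [show g (σ.symm j) = j from σ.apply_symm_apply j] at this
      exact this.symm

/-- An affine map, given by the images of the homogeneous coordinates, in homogeneous form. -/
def homVec {k B σ : Type*} [Field k] (W : Option B → σ → k) (b : Option B) : Option σ → k :=
  fun x => x.elim (b.elim 1 fun _ => 0) (W b)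

/-- The pullback of the form with coefficients `a` along an affine map. -/
noncomputable def pullback {k σ : Type*} [Field k] [Fintype σ] {d m : ℕ}
    (a : (Fin d → Option σ) → k) (W : Option (Fin m) → σ → k) : MvPolynomial (Fin m) k :=
  ∑ φ, MvPolynomial.C (a φ) * ∏ j, ∑ b, homCoord b * MvPolynomial.C (homVec W b (φ j))

theorem aeval_eq_pullback {k σ : Type*} [Field k] [Fintype σ] {d m : ℕ}
    (a : (Fin d → Option σ) → k) (W : Option (Fin m) → σ → k) :
    MvPolynomial.aeval (fun i => (∑ j : Fin m, MvPolynomial.C (W (some j) i) * MvPolynomial.X j) +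
      MvPolynomial.C (W none i)) (∑ φ, MvPolynomial.C (a φ) * ∏ j, homCoord (φ j)) =
    pullback a W := by
  simp only [pullback, map_sum, map_mul, map_prod, MvPolynomial.algHom_C,
    MvPolynomial.algebraMap_eq]
  refine sum_congr rfl fun φ _ => ?_
  congr 1
  refine prod_congr rfl fun j _ => ?_
  rw [Fintype.sum_option]
  cases φ j with
  | none => simp [homCoord, homVec]
  | some i => simp [homCoord, homVec, mul_comm, add_comm]

/-- Pullbacks of a form of large rank are closed under adding monomials. -/
theorem exists_pullback_eq_add {k : Type} [Field k] {d m n : ℕ} (hd : 0 < d)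
    (a : (Fin d → Option (Fin n)) → k)
    (h : ∀ W : Option (Fin m) → Option (Fin n) → k, ∃ u : Fin d → Fin n → k,
      symmetrize (coeffForm a) (extendZero k (Fin n)) u ≠ 0 ∧
      ∀ ρ : Fin d → Fin d ⊕ Option (Fin m),
        (∃ i j, ρ j = Sum.inl i) → (∃ i, ∀ j, ρ j ≠ Sum.inl i) →
        coeffForm a (fun j => Sum.elim (fun i => extendZero k (Fin n) (u i)) W (ρ j)) = 0)
    (W : Option (Fin m) → Fin n → k) (c : k) (φ₀ : Fin d → Option (Fin m)) :
    ∃ W' : Option (Fin m) → Fin n → k,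
      pullback a W' = pullback a W + MvPolynomial.C c * ∏ j, homCoord (φ₀ j) := by
  classical
  obtain ⟨u, hu, h0⟩ := h (homVec W)
  set z := symmetrize (coeffForm a) (extendZero k (Fin n)) u with hz
  let s : Fin d → k := fun i => if i = ⟨0, hd⟩ then c / z else 1
  have hs : ∏ i, s i = c / z := by simp [s]
  let r : Fin d ⊕ Option (Fin m) → MvPolynomial (Fin m) k :=
    Sum.elim (fun i => MvPolynomial.C (s i) * homCoord (φ₀ i)) homCoord
  let v : Fin d ⊕ Option (Fin m) → Option (Fin n) → k :=
    Sum.elim (fun i => extendZero k (Fin n) (u i)) (homVec W)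
  refine ⟨fun b => W b + ∑ i with φ₀ i = b, s i • u i, ?_⟩
  have h1 : ∀ x : Option (Fin n), ∑ b, homCoord b *
      MvPolynomial.C (homVec (fun b => W b + ∑ i with φ₀ i = b, s i • u i) b x) =
      ∑ t, r t * algebraMap k (MvPolynomial (Fin m) k) (v t x) := by
    intro x
    rw [Fintype.sum_sum_type, add_comm]
    cases x with
    | none => simp [r, v, homVec, extendZero]
    | some i =>
      simp only [homVec, Option.elim_some, Pi.add_apply, Finset.sum_apply, map_add, mul_add,
        sum_add_distrib, map_sum, mul_sum, sum_filter, r, v, Sum.elim_inl, Sum.elim_inr,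
        MvPolynomial.algebraMap_eq]
      congr 1
      rw [sum_comm]
      refine sum_congr rfl fun j _ => ?_
      rw [sum_eq_single (φ₀ j) (fun b _ hb => by simp [hb.symm]) (by simp)]
      simp [extendZero]
      ring
  have h2 := sum_mul_prod_sum_eq a (homCoord : Option (Fin m) → MvPolynomial (Fin m) k) (homVec W)
  have h3 := sum_mul_prod_sum_eq a r v
  rw [sum_mul_coeffForm_eq_add hd a r v h0] at h3
  rw [pullback, pullback]
  simp only [h1]
  rw [MvPolynomial.algebraMap_eq] at *
  rw [h2, h3]
  congr 1
  change (∏ i, MvPolynomial.C (s i) * homCoord (φ₀ i)) * MvPolynomial.C z = _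
  rw [prod_mul_distrib, ← map_prod, hs, mul_right_comm, ← map_mul, div_mul_cancel₀ _ hu]

/-- there is a threshold `r = r(m,d)` such that for every finite
field `k` of characteristic `> d` and every polynomial `P` of degree `≤ d` on
`k^n` of Schmidt rank `> r`, the pullback map `w ↦ P ∘ w` from affine maps
`w : k^m → k^n` to polynomials of degree `≤ d` on `k^m` is surjective. -/
theorem stmt_17 (d m : ℕ) (hd : 1 ≤ d) :
    ∃ r : ℕ, ∀ (k : Type) (_ : Field k) (_ : Fintype k), d < ringChar k →
      ∀ (n : ℕ) (P : MvPolynomial (Fin n) k), P.totalDegree ≤ d →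
        r < schmidtRank d P →
        ∀ Q : MvPolynomial (Fin m) k, Q.totalDegree ≤ d →
          ∃ (A : Fin n → Fin m → k) (c : Fin n → k),
            MvPolynomial.aeval
              (fun i : Fin n =>
                (∑ j : Fin m, MvPolynomial.C (A i j) * MvPolynomial.X j)
                  + MvPolynomial.C (c i)) P = Q := by
  obtain ⟨C, hC⟩ := exists_symmetrize_ne_zero d (m + 1) hd
  refine ⟨C + 1, fun k _ _ hk n P hP hr Q hQ => ?_⟩
  classical
  have hfac : (d.factorial : k) ≠ 0 := by
    have hp : (ringChar k).Prime := CharP.char_is_prime k _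
    rw [Ne, ringChar.spec, hp.dvd_factorial]
    omega
  obtain ⟨a, rfl⟩ := exists_eq_sum_prod_homCoord P hP
  have hrank : ¬ PartitionRankLE C (symmetrize (coeffForm a) (extendZero k (Fin n))) := fun h =>
    absurd (schmidtRank_le_of_partitionRankLE hd hfac a h) (not_le.2 hr)
  have hiso := hC k (Fin n → k) (Option (Fin n) → k) (Option (Fin m)) (coeffForm a)
    (extendZero k (Fin n)) (by simp) hrank
  have h0 : (pullback a (0 : Option (Fin m) → Fin n → k)).totalDegree = 0 := by
    rw [← aeval_eq_pullback]
    have : (fun i : Fin n => (∑ j : Fin m, MvPolynomial.C ((0 : Option (Fin m) → Fin n → k)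
        (some j) i) * MvPolynomial.X j) + MvPolynomial.C ((0 : Option (Fin m) → Fin n → k) none i))
        = (0 : Fin n → MvPolynomial (Fin m) k) := by
      ext; simp
    rw [this, MvPolynomial.aeval_zero, MvPolynomial.algebraMap_eq, MvPolynomial.totalDegree_C]
  obtain ⟨b, hb⟩ := exists_eq_sum_prod_homCoord (Q - pullback a 0)
    ((MvPolynomial.totalDegree_sub _ _).trans (max_le hQ (by rw [h0]; omega)))
  have hind : ∀ S : Finset (Fin d → Option (Fin m)), ∃ W : Option (Fin m) → Fin n → k,
      pullback a W = pullback a 0 + ∑ φ ∈ S, MvPolynomial.C (b φ) * ∏ j, homCoord (φ j) := by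
    intro S
    induction S using Finset.induction_on with
    | empty => exact ⟨0, by simp⟩
    | insert φ S hφ ih =>
      obtain ⟨W, hW⟩ := ih
      obtain ⟨W', hW'⟩ := exists_pullback_eq_add hd a hiso W (b φ) φ
      exact ⟨W', by rw [hW', hW, sum_insert hφ]; ring⟩
  obtain ⟨W, hW⟩ := hind univ
  rw [← hb, add_sub_cancel] at hW
  exact ⟨fun i j => W (some j) i, W none, (aeval_eq_pullback a W).trans hW⟩
end
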